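/- arXiv:2005.01450 — 3 statements merged into one kernel-verified Lean document; each statement's English description precedes it below -/
import Mathlib

section
/- Let N ∈ ℕ, c₀, C₁, C₂, a > 0 and b ≥ 0. Let (ℓ_j)_{j∈ℕ} be real numbers with ℓ_j ≥ c₀ for all j and #{j : ℓ_j ≤ R} ≤ C₁·e^{aR} for every R > 0, and let A_j ∈ M_N(ℂ) be matrices with ‖A_j‖ ≤ C₂·e^{b·ℓ_j} for all j. Then for every s ∈ ℂ with Re(s) > a + b one has Σ_j ‖A_j‖·e^{−Re(s)ℓ_j} < ∞, the family j ↦ det(I_N − e^{−sℓ_j}·A_j) is multipliable, and the function s ↦ ∏_j det(I_N − e^{−sℓ_j}·A_j) is holomorphic (complex differentiable) on the half-plane {s : Re(s) > a + b}. -/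
open scoped Matrix.Norms.L2Operator

/-- If the counting function of `ℓ` grows at most like `e^{aR}`, then `∑ e^{-tℓ_j}` converges for
`t > a`. -/
lemma summable_exp_neg_mul_of_ncard_le {ι : Type*} {C a t : ℝ} (ha : 0 < a) (hat : a < t)
    {ℓ : ι → ℝ} (hℓ : ∀ j, 0 ≤ ℓ j)
    (hcount : ∀ R > (0 : ℝ), {j | ℓ j ≤ R}.Finite ∧
      ({j | ℓ j ≤ R}.ncard : ℝ) ≤ C * Real.exp (a * R)) :
    Summable (fun j ↦ Real.exp (-t * ℓ j)) := by
  have hgeom : Summable (fun n : ℕ ↦ C * Real.exp a * Real.exp (n * (a - t))) :=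
    (Real.summable_exp_nat_mul_iff.mpr (sub_neg.mpr hat)).mul_left _
  have hC : 0 ≤ C := by
    by_contra! hC
    have h := (hcount 1 one_pos).2
    have h0 : (0 : ℝ) ≤ ({j | ℓ j ≤ 1}.ncard : ℝ) := Nat.cast_nonneg _
    nlinarith [Real.exp_pos (a * 1)]
  refine summable_of_sum_le (c := ∑' n : ℕ, C * Real.exp a * Real.exp (n * (a - t)))
    (fun j ↦ (Real.exp_pos _).le) fun F ↦ ?_
  classical
  rw [← Finset.sum_fiberwise_of_maps_to (t := F.image fun j ↦ ⌊ℓ j⌋₊)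
    (fun j hj ↦ Finset.mem_image_of_mem (fun j ↦ ⌊ℓ j⌋₊) hj)]
  refine (Finset.sum_le_sum fun n _ ↦ ?_).trans
    (hgeom.sum_le_tsum _ fun n _ ↦ by positivity)
  obtain ⟨hfin, hcard⟩ := hcount (n + 1) (by positivity)
  have hsub : ((F.filter fun j ↦ ⌊ℓ j⌋₊ = n).card : ℝ) ≤ C * Real.exp (a * (n + 1)) := by
    refine le_trans ?_ hcard
    rw [← Set.ncard_coe_finset, Nat.cast_le]
    refine Set.ncard_le_ncard (fun j hj ↦ ?_) hfin
    obtain ⟨-, rfl⟩ := Finset.mem_filter.mp hj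
    exact (Nat.lt_floor_add_one (ℓ j)).le
  calc ∑ j ∈ F.filter (fun j ↦ ⌊ℓ j⌋₊ = n), Real.exp (-t * ℓ j)
      ≤ (F.filter fun j ↦ ⌊ℓ j⌋₊ = n).card • Real.exp (-t * n) := by
        refine Finset.sum_le_card_nsmul _ _ _ fun j hj ↦ Real.exp_le_exp.mpr ?_
        obtain ⟨-, rfl⟩ := Finset.mem_filter.mp hj
        nlinarith [Nat.floor_le (hℓ j)]
    _ ≤ C * Real.exp (a * (n + 1)) * Real.exp (-t * n) := by
        rw [nsmul_eq_mul]
        gcongr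
    _ = C * Real.exp a * Real.exp (n * (a - t)) := by
        rw [mul_assoc, mul_assoc, ← Real.exp_add, ← Real.exp_add]
        ring_nf

/-- The determinant is complex differentiable as a function on square matrices. -/
lemma Matrix.differentiable_det {n : Type*} [Fintype n] [DecidableEq n] :
    Differentiable ℂ (Matrix.det : Matrix n n ℂ → ℂ) := by
  have hentry (i j : n) : Differentiable ℂ fun M : Matrix n n ℂ ↦ M i j :=
    (Matrix.entryLinearMap ℂ ℂ i j).toContinuousLinearMap.differentiable
  simp only [funext Matrix.det_apply']
  fun_prop

/-- Near the identity, the determinant is Lipschitz. -/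
lemma Matrix.exists_norm_det_one_sub_sub_one_le (n : Type*) [Fintype n] [DecidableEq n] :
    ∃ K δ : ℝ, 0 ≤ K ∧ 0 < δ ∧
      ∀ M : Matrix n n ℂ, ‖M‖ < δ → ‖(1 - M).det - 1‖ ≤ K * ‖M‖ := by
  have hdiff : DifferentiableAt ℂ (fun M : Matrix n n ℂ ↦ (1 - M).det) 0 :=
    (Matrix.differentiable_det _).comp 0 (by fun_prop)
  obtain ⟨K, hK, hbound⟩ := hdiff.isBigO_sub.exists_nonneg
  obtain ⟨δ, hδ, hball⟩ := Metric.eventually_nhds_iff.mp hbound.bound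
  refine ⟨K, δ, hK, hδ, fun M hM ↦ ?_⟩
  simpa using hball (y := M) (by simpa using hM)

/-- Abstract convergence and holomorphy of the twisted Ruelle zeta function on a
half-plane `Re s > a + b`. Matrices carry the `ℓ²` operator norm. -/
theorem ruelle_zeta_convergence_holomorphy
    (N : ℕ) (c₀ C₁ C₂ a b : ℝ) (hc₀ : 0 < c₀) (hC₁ : 0 < C₁) (hC₂ : 0 < C₂)
    (ha : 0 < a) (hb : 0 ≤ b)
    (ℓ : ℕ → ℝ) (hℓ : ∀ j, c₀ ≤ ℓ j)
    (hcount : ∀ R > (0 : ℝ), {j : ℕ | ℓ j ≤ R}.Finite ∧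
      ({j : ℕ | ℓ j ≤ R}.ncard : ℝ) ≤ C₁ * Real.exp (a * R))
    (A : ℕ → Matrix (Fin N) (Fin N) ℂ)
    (hA : ∀ j, ‖A j‖ ≤ C₂ * Real.exp (b * ℓ j)) :
    (∀ s : ℂ, a + b < s.re →
        Summable (fun j : ℕ => ‖A j‖ * Real.exp (-s.re * ℓ j))) ∧
    (∀ s : ℂ, a + b < s.re →
        Multipliable (fun j : ℕ =>
          Matrix.det (1 - Complex.exp (-s * (ℓ j : ℂ)) • A j))) ∧
    DifferentiableOn ℂ
      (fun s : ℂ => ∏' j : ℕ, Matrix.det (1 - Complex.exp (-s * (ℓ j : ℂ)) • A j))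
      {s : ℂ | a + b < s.re} := by
  have hpos (j : ℕ) : 0 ≤ ℓ j := hc₀.le.trans (hℓ j)
  have hsum (σ : ℝ) (hσ : a + b < σ) :
      Summable (fun j : ℕ ↦ ‖A j‖ * Real.exp (-σ * ℓ j)) := by
    refine Summable.of_nonneg_of_le (fun j ↦ by positivity) (fun j ↦ ?_)
      ((summable_exp_neg_mul_of_ncard_le ha (t := σ - b) (by linarith) hpos hcount).mul_left C₂)
    calc ‖A j‖ * Real.exp (-σ * ℓ j)
        ≤ C₂ * Real.exp (b * ℓ j) * Real.exp (-σ * ℓ j) := by gcongr; exact hA j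
      _ = C₂ * Real.exp (-(σ - b) * ℓ j) := by
        rw [mul_assoc, ← Real.exp_add]
        ring_nf
  have hdiff (j : ℕ) :
      Differentiable ℂ fun s : ℂ ↦ Matrix.det (1 - Complex.exp (-s * (ℓ j : ℂ)) • A j) :=
    Matrix.differentiable_det.comp (by fun_prop)
  obtain ⟨K, δ, hK, hδ, hdet⟩ := Matrix.exists_norm_det_one_sub_sub_one_le (Fin N)
  have hprod (σ : ℝ) (hσ : a + b < σ) : HasProdLocallyUniformlyOn
      (fun (j : ℕ) (s : ℂ) ↦ Matrix.det (1 - Complex.exp (-s * (ℓ j : ℂ)) • A j))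
      (fun s ↦ ∏' j : ℕ, Matrix.det (1 - Complex.exp (-s * (ℓ j : ℂ)) • A j))
      {s : ℂ | σ < s.re} := by
    have hopen : IsOpen {s : ℂ | σ < s.re} := isOpen_lt continuous_const Complex.continuous_re
    have hsmall := (hsum σ hσ).tendsto_atTop_zero.eventually_lt_const hδ
    convert Summable.hasProdLocallyUniformlyOn_nat_one_add
      (f := fun (j : ℕ) (s : ℂ) ↦ Matrix.det (1 - Complex.exp (-s * (ℓ j : ℂ)) • A j) - 1)
      hopen ((hsum σ hσ).mul_left K)
      (hsmall.mono fun j hj s hs ↦ by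
        have hnorm : ‖Complex.exp (-s * (ℓ j : ℂ)) • A j‖ ≤ ‖A j‖ * Real.exp (-σ * ℓ j) := by
          rw [norm_smul, Complex.norm_exp, mul_comm]
          gcongr
          simpa using mul_le_mul_of_nonneg_right (le_of_lt hs) (hpos j)
        exact (hdet _ (hnorm.trans_lt hj)).trans (by gcongr))
      (fun j ↦ ((hdiff j).continuous.sub continuous_const).continuousOn) <;>
      exact (add_sub_cancel _ _).symm
  refine ⟨fun s hs ↦ hsum s.re hs, fun s hs ↦ ?_, fun s hs ↦ ?_⟩
  · obtain ⟨σ, hσ, hσs⟩ := exists_between hs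
    exact ((hprod σ hσ).hasProd hσs).multipliable
  · obtain ⟨σ, hσ, hσs⟩ := exists_between (show a + b < s.re from hs)
    have hopen : IsOpen {s : ℂ | σ < s.re} := isOpen_lt continuous_const Complex.continuous_re
    have hlim := hasProdLocallyUniformlyOn_iff_tendstoLocallyUniformlyOn.mp (hprod σ hσ)
    have hlimdiff := hlim.differentiableOn (.of_forall fun F ↦
      DifferentiableOn.fun_finsetProd fun j _ ↦ (hdiff j).differentiableOn) hopen
    exact (hlimdiff.differentiableAt (hopen.mem_nhds hσs)).differentiableWithinAt
end

section
/- Let Γ be a subgroup of SL(2,ℝ) acting on the hyperbolic upper half-plane ℍ by Möbius transformations, and assume the action of Γ is free (γ•z = z for some z ∈ ℍ implies γ = 1), properly discontinuous (for every compact L ⊆ ℍ the set {γ ∈ Γ : γ•L ∩ L ≠ ∅} is finite), and cocompact (there is a compact K ⊆ ℍ with ⋃_{γ∈Γ} γ•K = ℍ). For γ ∈ Γ let ℓ(γ) := inf_{z∈ℍ} dist(z, γ•z) denote the translation length, where dist is the hyperbolic distance. Then for every n ∈ ℕ and every group homomorphism χ : Γ → GL(n,ℂ) there exist constants C, c > 0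 such that |tr(χ(γ))| ≤ C·e^{c·ℓ(γ)} for all γ ∈ Γ with γ ≠ 1. -/
open scoped MatrixGroups
open UpperHalfPlane

/-- Points far from `I` can be moved a bounded distance so that the hyperbolic cosine of the
distance to `I` decreases by a definite factor. -/
theorem UpperHalfPlane.exists_dist_le_and_cosh_dist_I_le (u : ℍ) (hu : 7 < Real.cosh (dist I u)) :
    ∃ v : ℍ, dist v u ≤ 5 / 2 ∧ Real.cosh (dist I v) ≤ 3 / 4 * Real.cosh (dist I u) := by
  have hy : 0 < u.im := u.im_pos
  have key (z w : ℍ) : Real.cosh (dist z w) =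
      1 + ((z.re - w.re) ^ 2 + (z.im - w.im) ^ 2) / (2 * z.im * w.im) := by
    rw [cosh_dist, Complex.dist_eq, ← Complex.normSq_eq_norm_sq, Complex.normSq_apply]
    simp [pow_two]
  have dist_le {v : ℍ} (hv : Real.cosh (dist v u) ≤ 5 / 2) : dist v u ≤ 5 / 2 :=
    (Real.self_le_sinh_iff.2 dist_nonneg).trans ((Real.sinh_lt_cosh _).le.trans hv)
  have hI (v : ℍ) : Real.cosh (dist I v) = (v.re ^ 2 + v.im ^ 2 + 1) / (2 * v.im) := by
    have := v.im_pos
    rw [key, I_re, I_im]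
    field_simp
    ring
  by_cases h : 5 * u.im ^ 2 ≤ u.re ^ 2 + 1
  · let v : ℍ := ⟨⟨u.re, 2 * u.im⟩, by simpa using hy⟩
    have hre : v.re = u.re := rfl
    have him : v.im = 2 * u.im := rfl
    refine ⟨v, dist_le ?_, ?_⟩
    · rw [key, hre, him, ← sub_nonneg]
      field_simp
      nlinarith
    · rw [hI, hI, hre, him, div_le_iff₀ (by positivity)]
      field_simp
      nlinarith
  · push Not at h
    let v : ℍ := ⟨⟨u.re / 2, u.im / 2⟩, by simpa using hy⟩
    have hre : v.re = u.re / 2 := rfl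
    have him : v.im = u.im / 2 := rfl
    refine ⟨v, dist_le ?_, ?_⟩
    · rw [key, hre, him, ← sub_nonneg]
      field_simp
      nlinarith
    · have hs : 5 ≤ u.re ^ 2 + u.im ^ 2 := by
        rw [hI, lt_div_iff₀ (by positivity)] at hu
        nlinarith
      rw [hI, hI, hre, him, div_le_iff₀ (by positivity)]
      field_simp
      nlinarith

/-- A submultiplicative function on a cocompact, properly discontinuous subgroup of `SL(2,ℝ)`
grows at most exponentially in the displacement of `I`. -/
theorem exists_le_exp_dist_of_submultiplicative (Γ : Subgroup SL(2, ℝ))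
    (hdisc : ∀ L : Set ℍ, IsCompact L →
      {γ : Γ | ((γ : SL(2, ℝ)) • ·) '' L ∩ L ≠ ∅}.Finite)
    (R : ℝ) (hR : 0 ≤ R) (hcov : ∀ z : ℍ, ∃ g : Γ, dist z ((g : SL(2, ℝ)) • I) ≤ R)
    (f : Γ → ℝ) (hf : ∀ g, 0 ≤ f g) (hmul : ∀ g h, f (g * h) ≤ f g * f h) :
    ∃ C c : ℝ, 0 < C ∧ 0 < c ∧
      ∀ g : Γ, f g ≤ C * Real.exp (c * dist I ((g : SL(2, ℝ)) • I)) := by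
  obtain ⟨M, hM1, hM⟩ : ∃ M : ℝ, 1 < M ∧
      ∀ g : Γ, dist I ((g : SL(2, ℝ)) • I) ≤ 2 * R + 7 → f g ≤ M := by
    have hfin := hdisc (Metric.closedBall I (2 * R + 7)) (isCompact_closedBall _ _)
    obtain ⟨M, hM⟩ := (hfin.image f).bddAbove
    refine ⟨max M 2, by simp, fun g hg ↦ (hM ⟨g, ?_, rfl⟩).trans (le_max_left _ _)⟩
    refine Set.Nonempty.ne_empty ⟨(g : SL(2, ℝ)) • I, ⟨I, ?_, rfl⟩, ?_⟩
    · exact Metric.mem_closedBall_self (by positivity)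
    · rwa [Metric.mem_closedBall, dist_comm]
  have hball (m : ℕ) : ∀ (u : ℍ) (g : Γ), Real.cosh (dist I u) ≤ 7 * (4 / 3) ^ m →
      dist u ((g : SL(2, ℝ)) • I) ≤ R → f g ≤ M ^ (m + 1) := by
    have base (u : ℍ) (g : Γ) (hu : Real.cosh (dist I u) ≤ 7)
        (hg : dist u ((g : SL(2, ℝ)) • I) ≤ R) : f g ≤ M := by
      have h7 : dist I u ≤ 7 :=
        (Real.self_le_sinh_iff.2 dist_nonneg).trans ((Real.sinh_lt_cosh _).le.trans hu)
      exact hM g (by linarith [dist_triangle I u ((g : SL(2, ℝ)) • I)])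
    induction m with
    | zero => exact fun u g hu hg ↦ by simpa using base u g (by simpa using hu) hg
    | succ m ih =>
      intro u g hu hg
      by_cases h7 : Real.cosh (dist I u) ≤ 7
      · exact (base u g h7 hg).trans (le_self_pow₀ hM1.le (by positivity))
      obtain ⟨v, hvu, hv⟩ := exists_dist_le_and_cosh_dist_I_le u (not_le.1 h7)
      obtain ⟨g', hg'⟩ := hcov v
      have h₁ : f g' ≤ M ^ (m + 1) := ih v g' (by rw [pow_succ] at hu; linarith) hg'
      have h₂ : f (g'⁻¹ * g) ≤ M := by
        apply hM
        rw [← dist_smul (g' : SL(2, ℝ)), smul_smul]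
        have : (g' : SL(2, ℝ)) * ((g'⁻¹ * g : Γ) : SL(2, ℝ)) = g := by simp
        rw [this]
        linarith [dist_triangle4 ((g' : SL(2, ℝ)) • I) v u ((g : SL(2, ℝ)) • I),
          dist_comm v ((g' : SL(2, ℝ)) • I)]
      calc f g = f (g' * (g'⁻¹ * g)) := by simp
        _ ≤ f g' * f (g'⁻¹ * g) := hmul _ _
        _ ≤ M ^ (m + 1) * M := mul_le_mul h₁ h₂ (hf _) (by positivity)
        _ = M ^ (m + 1 + 1) := (pow_succ _ _).symm
  have hlog : 0 < Real.log (4 / 3) := Real.log_pos (by norm_num)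
  have hlogM : 0 < Real.log M := Real.log_pos hM1
  refine ⟨Real.exp (Real.log M * 2), Real.log M / Real.log (4 / 3), Real.exp_pos _,
    div_pos hlogM hlog, fun g ↦ ?_⟩
  set d := dist I ((g : SL(2, ℝ)) • I)
  have hd0 : 0 ≤ d := dist_nonneg
  set m := ⌈d / Real.log (4 / 3)⌉₊
  have hm : d ≤ m * Real.log (4 / 3) := (div_le_iff₀ hlog).1 (Nat.le_ceil _)
  have hm' : (m : ℝ) < d / Real.log (4 / 3) + 1 := Nat.ceil_lt_add_one (by positivity)
  have hcosh : Real.cosh d ≤ 7 * (4 / 3) ^ m := by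
    have h₁ : Real.cosh d ≤ Real.exp d := by
      rw [← Real.cosh_add_sinh]
      linarith [Real.sinh_nonneg_iff.2 hd0]
    have h₂ : Real.exp d ≤ (4 / 3) ^ m := by
      rw [← Real.exp_log (show (0 : ℝ) < 4 / 3 by norm_num), ← Real.exp_nat_mul]
      exact Real.exp_le_exp.2 (by simpa using hm)
    linarith [pow_pos (show (0 : ℝ) < 4 / 3 by norm_num) m]
  refine (hball m _ g hcosh (by simpa using hR)).trans ?_
  rw [← Real.exp_add]
  nth_rewrite 1 [← Real.exp_log (zero_lt_one.trans hM1)]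
  rw [← Real.exp_nat_mul]
  apply Real.exp_le_exp.2
  push_cast
  calc ((m : ℝ) + 1) * Real.log M ≤ (d / Real.log (4 / 3) + 2) * Real.log M :=
        mul_le_mul_of_nonneg_right (by linarith) hlogM.le
    _ = Real.log M * 2 + Real.log M / Real.log (4 / 3) * d := by ring

attribute [local instance] Matrix.linftyOpNormedRing in
/-- On complex square matrices there is a submultiplicative function dominating the trace. -/
theorem Matrix.exists_submultiplicative_norm_trace_le (n : ℕ) :
    ∃ N : Matrix (Fin n) (Fin n) ℂ → ℝ, (∀ A, 0 ≤ N A) ∧ (∀ A B, N (A * B) ≤ N A * N B) ∧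
      ∀ A, ‖A.trace‖ ≤ n * N A := by
  refine ⟨fun A ↦ ‖A‖, fun A ↦ norm_nonneg A, fun A B ↦ norm_mul_le A B, fun A ↦ ?_⟩
  have hdiag (i : Fin n) : ‖A i i‖ ≤ ‖A‖ := by
    rw [Matrix.linfty_opNorm_def]
    exact_mod_cast (Finset.single_le_sum (f := fun j ↦ ‖A i j‖₊) (fun _ _ ↦ zero_le)
      (Finset.mem_univ i)).trans
      (Finset.le_sup (f := fun i ↦ ∑ j, ‖A i j‖₊) (Finset.mem_univ i))
  calc ‖A.trace‖ ≤ ∑ i, ‖A i i‖ := norm_sum_le _ _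
    _ ≤ ∑ _i : Fin n, ‖A‖ := Finset.sum_le_sum fun i _ ↦ hdiag i
    _ = n * ‖A‖ := by simp

/-- For a free, properly discontinuous, cocompact subgroup `Γ` of `SL(2,ℝ)` acting on the
hyperbolic upper half-plane, and any finite dimensional representation `χ : Γ → GL(n,ℂ)`,
there are constants `C, c > 0` with `|tr χ(γ)| ≤ C·e^{c·ℓ(γ)}` for all `γ ≠ 1`, where
`ℓ(γ)` is the translation length of `γ`. -/
theorem trace_bound_of_representation
    (Γ : Subgroup SL(2, ℝ))
    (hfree : ∀ (γ : Γ) (z : ℍ), (γ : SL(2, ℝ)) • z = z → γ = 1)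
    (hdisc : ∀ L : Set ℍ, IsCompact L →
      {γ : Γ | ((γ : SL(2, ℝ)) • ·) '' L ∩ L ≠ ∅}.Finite)
    (hcocompact : ∃ K : Set ℍ, IsCompact K ∧ ⋃ γ : Γ, ((γ : SL(2, ℝ)) • ·) '' K = Set.univ)
    (n : ℕ) (χ : Γ →* GL (Fin n) ℂ) :
    ∃ C c : ℝ, 0 < C ∧ 0 < c ∧ ∀ γ : Γ, γ ≠ 1 →
      ‖Matrix.trace ((χ γ : GL (Fin n) ℂ) : Matrix (Fin n) (Fin n) ℂ)‖ ≤
        C * Real.exp (c * ⨅ z : ℍ, dist z ((γ : SL(2, ℝ)) • z)) := by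
  obtain ⟨K, hK, hKcov⟩ := hcocompact
  obtain ⟨R, hR, hcov⟩ : ∃ R : ℝ, 0 ≤ R ∧
      ∀ z : ℍ, ∃ g : Γ, dist z ((g : SL(2, ℝ)) • I) ≤ R := by
    obtain ⟨R, hKR⟩ := hK.isBounded.subset_closedBall I
    refine ⟨max R 0, le_max_right _ _, fun z ↦ ?_⟩
    obtain ⟨g, k, hk, rfl⟩ := Set.mem_iUnion.1 (hKcov ▸ Set.mem_univ z)
    refine ⟨g, ?_⟩
    simpa only [dist_smul] using (Metric.mem_closedBall.1 (hKR hk)).trans (le_max_left _ _)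
  obtain ⟨N, hN, hNmul, hNtr⟩ := Matrix.exists_submultiplicative_norm_trace_le n
  obtain ⟨C, c, hC, hc, hbound⟩ := exists_le_exp_dist_of_submultiplicative Γ hdisc R hR hcov
    (fun g ↦ N (χ g)) (fun g ↦ hN _) (fun g h ↦ by simpa using hNmul (χ g) (χ h))
  refine ⟨(n + 1) * (C * Real.exp (c * (2 * R + 1))), c, by positivity, hc, fun γ _ ↦ ?_⟩
  set ℓ := ⨅ z : ℍ, dist z ((γ : SL(2, ℝ)) • z)
  obtain ⟨z, hz⟩ : ∃ z : ℍ, dist z ((γ : SL(2, ℝ)) • z) < ℓ + 1 :=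
    exists_lt_of_ciInf_lt (lt_add_one ℓ)
  obtain ⟨g, hg⟩ := hcov z
  have hconj : dist I (((g⁻¹ * γ * g : Γ) : SL(2, ℝ)) • I) ≤ 2 * R + 1 + ℓ := by
    rw [← dist_smul (g : SL(2, ℝ)), smul_smul]
    have : (g : SL(2, ℝ)) * ((g⁻¹ * γ * g : Γ) : SL(2, ℝ)) = γ * g := by simp [mul_assoc]
    rw [this, mul_smul]
    have h := dist_triangle4 ((g : SL(2, ℝ)) • I) z ((γ : SL(2, ℝ)) • z)
      ((γ : SL(2, ℝ)) • (g : SL(2, ℝ)) • I)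
    rw [dist_smul, dist_comm _ z] at h
    linarith
  have htr : ((χ γ : GL (Fin n) ℂ) : Matrix (Fin n) (Fin n) ℂ).trace =
      ((χ (g⁻¹ * γ * g) : GL (Fin n) ℂ) : Matrix (Fin n) (Fin n) ℂ).trace := by
    rw [map_mul, map_mul, map_inv, Units.val_mul, Units.val_mul, Matrix.trace_units_conj']
  have hexp : N (χ (g⁻¹ * γ * g)) ≤ C * Real.exp (c * (2 * R + 1 + ℓ)) :=
    (hbound _).trans (by gcongr)
  calc ‖((χ γ : GL (Fin n) ℂ) : Matrix (Fin n) (Fin n) ℂ).trace‖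
      ≤ n * N (χ (g⁻¹ * γ * g)) := htr ▸ hNtr _
    _ ≤ (n + 1) * (C * Real.exp (c * (2 * R + 1 + ℓ))) :=
        mul_le_mul (by linarith) hexp (hN _) (by positivity)
    _ = (n + 1) * (C * Real.exp (c * (2 * R + 1))) * Real.exp (c * ℓ) := by
        rw [mul_add c, Real.exp_add]
        ring
end

section
/- Let δ > 0, M ≥ 1, C > 0, q > 0. Let λ : ℕ → ℂ and m : ℕ → ℕ satisfy: Re(λ_k) ≥ δ for all k; |λ_k| ≤ M·Re(λ_k) for all k; and Σ_{k : |λ_k| ≤ r} m_k ≤ C·(1+r)^q for every r > 0. For s ∈ ℂ write λ^{−s} := exp(−s·Log λ) with Log the principal branch of the logarithm. Then for every s ∈ ℂ with Re(s) > q the series Σ_k m_k·λ_k^{−s} converges absolutely, the function t ↦ t^{s−1}·Σ_k m_k e^{−tλ_k} is integrable on (0,∞), and Σ_k m_k·λ_k^{−s} = (1/Γ(s))·∫_0^∞ t^{s−1}·(Σ_k m_k·e^{−tλ_k}) dt. -/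
section

open MeasureTheory Set Filter Topology

theorem MeasureTheory.integrable_tsum_of_summable_integral_norm {α ι E : Type*} [Countable ι]
    [MeasurableSpace α] {μ : Measure α} [NormedAddCommGroup E] [NormedSpace ℝ E] [CompleteSpace E]
    {F : ι → α → E} (hF_int : ∀ i, Integrable (F i) μ)
    (hF_sum : Summable fun i ↦ ∫ a, ‖F i a‖ ∂μ) :
    Integrable (fun a ↦ ∑' i, F i a) μ := by
  have hfin : ∫⁻ a, ∑' i, ‖F i a‖ₑ ∂μ < ⊤ := by
    rw [lintegral_tsum fun i ↦ (hF_int i).1.enorm]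
    simp_rw [← fun i ↦ ofReal_integral_norm_eq_lintegral_enorm (hF_int i)]
    exact hF_sum.tsum_ofReal_lt_top
  have hae : ∀ᵐ a ∂μ, Summable fun i ↦ ‖F i a‖ := by
    filter_upwards [ae_lt_top' (AEMeasurable.tsum fun i ↦ (hF_int i).1.enorm) hfin.ne]
      with a ha
    exact tsum_enorm_ne_top_iff_summable_norm.mp ha.ne
  refine ⟨aestronglyMeasurable_of_tendsto_ae atTop
    (fun s : Finset ι ↦ (integrable_finsetSum s fun i _ ↦ hF_int i).1) ?_, ?_⟩
  · filter_upwards [hae] with a ha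
    simpa [HasSum] using ha.of_norm.hasSum
  · refine (lintegral_mono_ae ?_).trans_lt hfin
    filter_upwards [hae] with a ha
    exact enorm_tsum_le_tsum_enorm

theorem Complex.integrableOn_cpow_mul_exp_neg_mul_Ioi {s z : ℂ} (hs : 0 < s.re) (hz : 0 < z.re) :
    IntegrableOn (fun t : ℝ ↦ (t : ℂ) ^ (s - 1) * exp (-t * z)) (Ioi 0) := by
  have hmeas : AEStronglyMeasurable (fun t : ℝ ↦ (t : ℂ) ^ (s - 1) * exp (-t * z))
      (volume.restrict (Ioi 0)) := by
    refine ContinuousOn.aestronglyMeasurable (fun t ht ↦ ?_) measurableSet_Ioi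
    refine (ContinuousAt.mul ?_ (by fun_prop)).continuousWithinAt
    exact continuousAt_ofReal_cpow_const _ _ (Or.inr (ne_of_gt ht))
  have h := integrableOn_rpow_mul_exp_neg_mul_rpow (p := 1) (s := s.re - 1) (by linarith)
    one_pos hz
  refine (integrable_norm_iff hmeas).mp (h.congr_fun (fun t ht ↦ ?_) measurableSet_Ioi)
  simp [norm_cpow_eq_rpow_re_of_pos (show 0 < t from ht), Complex.norm_exp, mul_comm]

theorem Complex.integral_norm_cpow_mul_exp_neg_mul_Ioi {s z : ℂ} (hs : 0 < s.re) (hz : 0 < z.re) :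
    ∫ t : ℝ in Ioi 0, ‖(t : ℂ) ^ (s - 1) * exp (-t * z)‖ = (1 / z.re) ^ s.re * Real.Gamma s.re := by
  rw [← Real.integral_rpow_mul_exp_neg_mul_Ioi hs hz]
  refine setIntegral_congr_fun measurableSet_Ioi fun t ht ↦ ?_
  simp [norm_cpow_eq_rpow_re_of_pos (show 0 < t from ht), Complex.norm_exp, mul_comm]

theorem Complex.differentiableAt_integral_cpow_mul_exp_neg_mul_Ioi {s z : ℂ} (hs : 0 < s.re)
    (hz : 0 < z.re) :
    DifferentiableAt ℂ (fun w ↦ ∫ t : ℝ in Ioi 0, (t : ℂ) ^ (s - 1) * exp (-t * w)) z := by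
  have hs' : 0 < (s + 1).re := by simp; linarith
  have hz2 : 0 < ((z.re / 2 : ℝ) : ℂ).re := by simpa using hz
  refine (hasDerivAt_integral_of_dominated_loc_of_deriv_le
    (F := fun w (t : ℝ) ↦ (t : ℂ) ^ (s - 1) * exp (-t * w)) (s := {w : ℂ | z.re / 2 < w.re}) (F' := fun w (t : ℝ) ↦ -((t : ℂ) ^ (s + 1 - 1) * exp (-t * w)))
    (bound := fun t : ℝ ↦ ‖(t : ℂ) ^ (s + 1 - 1) * exp (-t * ((z.re / 2 : ℝ) : ℂ))‖)
    ((isOpen_lt continuous_const continuous_re).mem_nhds (by simpa using hz)) ?_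
    (integrableOn_cpow_mul_exp_neg_mul_Ioi hs hz)
    (integrableOn_cpow_mul_exp_neg_mul_Ioi hs' hz).1.neg ?_
    (integrableOn_cpow_mul_exp_neg_mul_Ioi hs' hz2).norm ?_).2.differentiableAt
  · filter_upwards [(isOpen_lt continuous_const continuous_re).mem_nhds hz] with w hw
    exact (integrableOn_cpow_mul_exp_neg_mul_Ioi hs hw).1
  · filter_upwards [ae_restrict_mem measurableSet_Ioi] with t ht w hw
    rw [norm_neg, norm_mul, norm_mul, Complex.norm_exp, Complex.norm_exp]
    have h : t * (z.re / 2) ≤ t * w.re := mul_le_mul_of_nonneg_left (le_of_lt hw) (le_of_lt ht)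
    refine mul_le_mul_of_nonneg_left (Real.exp_le_exp.mpr ?_) (norm_nonneg _)
    rw [← ofReal_neg, re_ofReal_mul, re_ofReal_mul, ofReal_re]
    linarith
  · filter_upwards [ae_restrict_mem measurableSet_Ioi] with t ht w _
    have ht0 : (t : ℂ) ≠ 0 := ofReal_ne_zero.mpr (ne_of_gt ht)
    have h := (((hasDerivAt_id w).const_mul (-(t : ℂ))).cexp).const_mul ((t : ℂ) ^ (s - 1))
    refine h.congr_deriv ?_
    rw [show s + 1 - 1 = s - 1 + 1 by ring, cpow_add _ _ ht0, cpow_one, id_eq]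
    ring

theorem Complex.integral_cpow_mul_exp_neg_mul_Ioi_of_re_pos {s z : ℂ} (hs : 0 < s.re)
    (hz : 0 < z.re) :
    ∫ t : ℝ in Ioi 0, (t : ℂ) ^ (s - 1) * exp (-t * z) = Gamma s * exp (-s * log z) := by
  have hU : IsOpen {w : ℂ | 0 < w.re} := isOpen_lt continuous_const continuous_re
  have hf : AnalyticOnNhd ℂ (fun w ↦ ∫ t : ℝ in Ioi 0, (t : ℂ) ^ (s - 1) * exp (-t * w))
      {w : ℂ | 0 < w.re} :=
    DifferentiableOn.analyticOnNhd (fun w hw ↦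
      (differentiableAt_integral_cpow_mul_exp_neg_mul_Ioi hs hw).differentiableWithinAt) hU
  have hg : AnalyticOnNhd ℂ (fun w ↦ Gamma s * exp (-s * log w)) {w : ℂ | 0 < w.re} :=
    DifferentiableOn.analyticOnNhd (fun w hw ↦
      (((differentiableAt_id.clog (Or.inl hw)).const_mul (-s)).cexp.const_mul
        (Gamma s)).differentiableWithinAt) hU
  refine hf.eqOn_of_preconnected_of_frequently_eq hg
    (convex_halfSpace_re_gt 0).isPreconnected (z₀ := ((1 : ℝ) : ℂ)) (by simp) ?_ hz
  have ht : Tendsto ((↑) : ℝ → ℂ) (𝓝[≠] 1) (𝓝[≠] ((1 : ℝ) : ℂ)) :=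
    continuous_ofReal.continuousAt.continuousWithinAt.tendsto_nhdsWithin
      fun x hx ↦ by simpa using hx
  refine ht.frequently (Eventually.frequently ?_)
  filter_upwards [nhdsWithin_le_nhds (lt_mem_nhds one_pos)] with r hr
  have h := integral_cpow_mul_exp_neg_mul_Ioi hs hr
  rw [one_div, inv_cpow _ _ (by rw [arg_ofReal_of_nonneg hr.le]; exact Real.pi_pos.ne),
    ← cpow_neg, cpow_def_of_ne_zero (ofReal_ne_zero.mpr hr.ne')] at h
  rw [mul_comm (Gamma s), mul_comm (-s), ← h]
  simp [mul_comm]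

theorem summable_mul_rpow_neg_of_sum_le {ι : Type*} {a ρ : ι → ℝ} {δ C q σ : ℝ} (hδ : 0 < δ)
    (hC : 0 ≤ C) (hq : 0 ≤ q) (hσ : q < σ) (ha : ∀ k, 0 ≤ a k) (hρ : ∀ k, δ ≤ ρ k)
    (hgrowth : ∀ r > 0, ∀ S : Finset ι, (∀ k ∈ S, ρ k ≤ r) → ∑ k ∈ S, a k ≤ C * (1 + r) ^ q) :
    Summable fun k ↦ a k * ρ k ^ (-σ) := by
  classical
  set c : ℝ := 2 * max 1 δ⁻¹ with hc
  have hmax : (1 : ℝ) ≤ max 1 δ⁻¹ := le_max_left _ _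
  have hc0 : 0 < c := by linarith
  have hρ0 : ∀ k, 0 < ρ k := fun k ↦ hδ.trans_le (hρ k)
  have hdyadic : ∀ k, ∃ j : ℕ, ρ k ≤ 2 ^ j ∧ 2 ^ j ≤ c * ρ k := by
    intro k
    rcases le_total 1 (ρ k) with h | h
    · obtain ⟨n, hn, hn'⟩ := exists_nat_pow_near h one_lt_two
      refine ⟨n + 1, hn'.le, ?_⟩
      rw [pow_succ]
      nlinarith
    · refine ⟨0, by simpa using h, ?_⟩
      have h1 : 1 ≤ δ⁻¹ * ρ k := by
        rw [inv_mul_eq_div, one_le_div hδ]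
        exact hρ k
      have h2 : δ⁻¹ * ρ k ≤ max 1 δ⁻¹ * ρ k :=
        mul_le_mul_of_nonneg_right (le_max_right _ _) (hρ0 k).le
      rw [pow_zero, hc]
      linarith
  choose j hj hj' using hdyadic
  set K : ℝ := c ^ σ * (C * 2 ^ q) with hK
  have hgeom : Summable fun n : ℕ ↦ K * ((2 : ℝ) ^ (q - σ)) ^ n :=
    (summable_geometric_of_lt_one (by positivity)
      (Real.rpow_lt_one_of_one_lt_of_neg one_lt_two (by linarith))).mul_left _
  have hshell : ∀ (S : Finset ι) (n : ℕ),
      ∑ k ∈ S with j k = n, a k * ρ k ^ (-σ) ≤ K * ((2 : ℝ) ^ (q - σ)) ^ n := by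
    intro S n
    have hterm : ∀ k ∈ S.filter (j · = n),
        a k * ρ k ^ (-σ) ≤ a k * (c ^ σ * ((2 : ℝ) ^ n) ^ (-σ)) := by
      intro k hk
      obtain rfl := (Finset.mem_filter.mp hk).2
      refine mul_le_mul_of_nonneg_left ?_ (ha k)
      have h := Real.rpow_le_rpow_of_nonpos (by positivity) (hj' k) (by linarith : -σ ≤ 0)
      rw [Real.mul_rpow hc0.le (hρ0 k).le] at h
      calc ρ k ^ (-σ) = c ^ σ * (c ^ (-σ) * ρ k ^ (-σ)) := by
            rw [← mul_assoc, ← Real.rpow_add hc0, add_neg_cancel, Real.rpow_zero, one_mul]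
        _ ≤ _ := by gcongr
    have hsum : ∑ k ∈ S with j k = n, a k ≤ C * (2 ^ q * ((2 : ℝ) ^ n) ^ q) := by
      refine (hgrowth (2 ^ n) (by positivity) _ fun k hk ↦ ?_).trans ?_
      · exact (Finset.mem_filter.mp hk).2 ▸ hj k
      · rw [← Real.mul_rpow two_pos.le (by positivity)]
        have : (1 : ℝ) ≤ 2 ^ n := one_le_pow₀ one_le_two
        gcongr
        linarith
    calc _ ≤ ∑ k ∈ S with j k = n, a k * (c ^ σ * ((2 : ℝ) ^ n) ^ (-σ)) := Finset.sum_le_sum hterm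
      _ = (∑ k ∈ S with j k = n, a k) * (c ^ σ * ((2 : ℝ) ^ n) ^ (-σ)) := by rw [Finset.sum_mul]
      _ ≤ C * (2 ^ q * ((2 : ℝ) ^ n) ^ q) * (c ^ σ * ((2 : ℝ) ^ n) ^ (-σ)) := by gcongr
      _ = K * (((2 : ℝ) ^ n) ^ q * ((2 : ℝ) ^ n) ^ (-σ)) := by rw [hK]; ring
      _ = _ := by
        rw [← Real.rpow_add (by positivity), ← sub_eq_add_neg, ← Real.rpow_natCast,
          ← Real.rpow_natCast, ← Real.rpow_mul two_pos.le, ← Real.rpow_mul two_pos.le,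
          mul_comm (n : ℝ)]
  refine summable_of_sum_le (c := ∑' n, K * ((2 : ℝ) ^ (q - σ)) ^ n)
    (fun k ↦ mul_nonneg (ha k) (Real.rpow_nonneg (hρ0 k).le _)) fun S ↦ ?_
  rw [← Finset.sum_fiberwise_of_maps_to fun k hk ↦ Finset.mem_image_of_mem j hk]
  exact (Finset.sum_le_sum fun n _ ↦ hshell S n).trans
    (hgeom.sum_le_tsum _ fun n _ ↦ by positivity)

theorem Complex.norm_exp_neg_mul_log_le {s z : ℂ} (hz : z ≠ 0) :
    ‖exp (-s * log z)‖ ≤ Real.exp (|s.im| * Real.pi) * ‖z‖ ^ (-s.re) := by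
  have hz' : 0 < ‖z‖ := norm_pos_iff.mpr hz
  rw [Complex.norm_exp, Real.rpow_def_of_pos hz', ← Real.exp_add, Real.exp_le_exp]
  have h : s.im * arg z ≤ |s.im| * Real.pi :=
    (le_abs_self _).trans (by rw [abs_mul]; gcongr; exact abs_arg_le_pi z)
  simp only [neg_mul, neg_re, mul_re, log_re, log_im]
  linarith

end

/-- Mellin-transform representation of the spectral zeta function
`ζ(s) = Σ_k m_k λ_k^{-s}` (with `λ^{-s} := exp(-s·Log λ)`, principal branch) of a
non-self-adjoint elliptic operator whose generalized eigenvalues satisfy `Re λ_k ≥ δ > 0`,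
lie in a sector `|λ| ≤ M·Re λ`, and obey the Weyl law `Σ_{|λ_k| ≤ r} m_k ≤ C(1+r)^q`:
for `Re s > q`, `ζ(s) = (1/Γ(s)) ∫_0^∞ t^{s-1} (Σ_k m_k e^{-tλ_k}) dt`. -/
theorem spectral_zeta_mellin_representation
    (δ M C q : ℝ) (hδ : 0 < δ) (hM : 1 ≤ M) (hC : 0 < C) (hq : 0 < q)
    (lam : ℕ → ℂ) (m : ℕ → ℕ)
    (hre : ∀ k, δ ≤ (lam k).re)
    (hsector : ∀ k, ‖lam k‖ ≤ M * (lam k).re)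
    (hweyl : ∀ r > (0 : ℝ), ∀ S : Finset ℕ, (∀ k ∈ S, ‖lam k‖ ≤ r) →
      ((∑ k ∈ S, m k : ℕ) : ℝ) ≤ C * (1 + r) ^ q) :
    ∀ s : ℂ, q < s.re →
      Summable (fun k : ℕ => ‖(m k : ℂ) * Complex.exp (-s * Complex.log (lam k))‖) ∧
      MeasureTheory.IntegrableOn
        (fun t : ℝ => (t : ℂ) ^ (s - 1) *
          ∑' k : ℕ, (m k : ℂ) * Complex.exp (-(t : ℂ) * lam k)) (Set.Ioi 0) ∧
      ∑' k : ℕ, (m k : ℂ) * Complex.exp (-s * Complex.log (lam k)) =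
        (1 / Complex.Gamma s) *
          ∫ t in Set.Ioi (0 : ℝ),
            (t : ℂ) ^ (s - 1) * ∑' k : ℕ, (m k : ℂ) * Complex.exp (-(t : ℂ) * lam k) := by
  intro s hs
  have hs0 : 0 < s.re := hq.trans hs
  have hre0 : ∀ k, 0 < (lam k).re := fun k ↦ hδ.trans_le (hre k)
  have hne : ∀ k, lam k ≠ 0 := fun k h ↦ (hre0 k).ne' (by simp [h])
  have hnorm : ∀ k, 0 < ‖lam k‖ := fun k ↦ norm_pos_iff.mpr (hne k)
  have hM0 : 0 < M := one_pos.trans_le hM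
  have hsum : Summable fun k ↦ (m k : ℝ) * ‖lam k‖ ^ (-s.re) :=
    summable_mul_rpow_neg_of_sum_le hδ hC.le hq.le hs (fun k ↦ Nat.cast_nonneg _)
      (fun k ↦ (hre k).trans (Complex.re_le_norm _))
      fun r hr S hS ↦ by simpa using hweyl r hr S hS
  have hint : ∀ k, MeasureTheory.IntegrableOn (fun t : ℝ ↦
      (t : ℂ) ^ (s - 1) * ((m k : ℂ) * Complex.exp (-(t : ℂ) * lam k))) (Set.Ioi 0) := by
    intro k
    simp_rw [mul_left_comm _ (m k : ℂ)]
    exact (Complex.integrableOn_cpow_mul_exp_neg_mul_Ioi hs0 (hre0 k)).const_mul _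
  have hint_sum : Summable fun k ↦ ∫ t : ℝ in Set.Ioi 0,
      ‖(t : ℂ) ^ (s - 1) * ((m k : ℂ) * Complex.exp (-(t : ℂ) * lam k))‖ := by
    refine (hsum.mul_left (M ^ s.re * Real.Gamma s.re)).of_nonneg_of_le
      (fun k ↦ MeasureTheory.integral_nonneg fun t ↦ norm_nonneg _) fun k ↦ ?_
    simp_rw [mul_left_comm _ (m k : ℂ), norm_mul (m k : ℂ)]
    rw [MeasureTheory.integral_const_mul,
      Complex.integral_norm_cpow_mul_exp_neg_mul_Ioi hs0 (hre0 k), Complex.norm_natCast]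
    have hinv : 1 / (lam k).re ≤ M * ‖lam k‖⁻¹ := by
      rw [← div_eq_mul_inv, div_le_div_iff₀ (hre0 k) (hnorm k), one_mul]
      exact hsector k
    have hpow : (1 / (lam k).re) ^ s.re ≤ M ^ s.re * ‖lam k‖ ^ (-s.re) := by
      rw [Real.rpow_neg (hnorm k).le, ← Real.inv_rpow (hnorm k).le,
        ← Real.mul_rpow hM0.le (inv_nonneg.mpr (hnorm k).le)]
      exact Real.rpow_le_rpow (one_div_nonneg.mpr (hre0 k).le) hinv hs0.le
    have hΓ : 0 ≤ Real.Gamma s.re := (Real.Gamma_pos_of_pos hs0).le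
    calc (m k : ℝ) * ((1 / (lam k).re) ^ s.re * Real.Gamma s.re)
        ≤ m k * (M ^ s.re * ‖lam k‖ ^ (-s.re) * Real.Gamma s.re) := by gcongr
      _ = _ := by ring
  simp_rw [← tsum_mul_left (a := ((_ : ℝ) : ℂ) ^ (s - 1))]
  refine ⟨?_, MeasureTheory.integrable_tsum_of_summable_integral_norm hint hint_sum, ?_⟩
  · refine (hsum.mul_left (Real.exp (|s.im| * Real.pi))).of_nonneg_of_le
      (fun k ↦ norm_nonneg _) fun k ↦ ?_
    rw [norm_mul, Complex.norm_natCast, mul_left_comm]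
    exact mul_le_mul_of_nonneg_left (Complex.norm_exp_neg_mul_log_le (hne k)) (Nat.cast_nonneg _)
  · rw [← MeasureTheory.integral_tsum_of_summable_integral_norm hint hint_sum, ← tsum_mul_left]
    refine tsum_congr fun k ↦ ?_
    simp_rw [mul_left_comm _ (m k : ℂ)]
    rw [MeasureTheory.integral_const_mul,
      Complex.integral_cpow_mul_exp_neg_mul_Ioi_of_re_pos hs0 (hre0 k)]
    have hΓ : Complex.Gamma s ≠ 0 := Complex.Gamma_ne_zero_of_re_pos hs0
    field_simp
end
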